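/- arXiv:2006.10587 — 5 statements merged into one kernel-verified Lean document; each statement's English description precedes it below -/
import Mathlib

section
/- Suppose the family pb satisfies the self-add rule and the neighbor replacement rule. If the system is in deadlock at epoch t (i.e., D(i,t) holds for every agent i ∈ A), then for every edge {i,j} ∈ E both agents' partial blocks contain both IDs: i ∈ pb_i(t), j ∈ pb_i(t), i ∈ pb_j(t), and j ∈ pb_j(t). (Lemma 2 of the paper.) -/
theorem card_symmDiff_mem {A : Type*} [DecidableEq A] (s : Finset A) (a : A) (h : a ∈ s) :
    (symmDiff s {a}).card + 1 = s.card := by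
  have : symmDiff s {a} = s.erase a := by
    ext x; simp only [Finset.mem_symmDiff, Finset.mem_singleton, Finset.mem_erase]; grind
  rw [this, Finset.card_erase_add_one h]

theorem card_symmDiff_not_mem {A : Type*} [DecidableEq A] (s : Finset A) (a : A) (h : a ∉ s) :
    (symmDiff s {a}).card = s.card + 1 := by
  have : symmDiff s {a} = insert a s := by
    ext x; simp only [Finset.mem_symmDiff, Finset.mem_singleton, Finset.mem_insert]; grind
  rw [this, Finset.card_insert_of_notMem h]

/-- Lemma 2: Under the self-add rule and the neighbor replacement rule, if the
system is in deadlock at epoch `t`, then for every edge `{i, j}` both agents'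
partial blocks contain both IDs. -/
theorem lemma2_have_eachother
    {A : Type*} [Fintype A] [DecidableEq A] [Nonempty A]
    (G : SimpleGraph A) (hconn : G.Connected)
    (pb : A → ℕ → Finset A) (L : ℕ)
    (hself : ∀ i t, i ∉ pb i t → (pb i t).card < L → pb i (t + 1) ≠ pb i t)
    (hnbr : ∀ i j t, G.Adj i j →
      (symmDiff (pb i t) {i}).card < (symmDiff (pb j t) {i}).card →
      (pb i t).card < L → pb i (t + 1) ≠ pb i t)
    (t : ℕ)
    (hdead : ∀ i, pb i t = pb i (t + 1) ∧ (pb i t).card < L) :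
    ∀ i j, G.Adj i j →
      i ∈ pb i t ∧ j ∈ pb i t ∧ i ∈ pb j t ∧ j ∈ pb j t := by
  have hs : ∀ i, i ∈ pb i t := fun i => by
    by_contra h
    exact hself i t h (hdead i).2 (hdead i).1.symm
  have hn : ∀ i j, G.Adj i j →
      (symmDiff (pb j t) {i}).card ≤ (symmDiff (pb i t) {i}).card := fun i j hij => by
    by_contra h
    exact hnbr i j t hij (not_le.mp h) (hdead i).2 (hdead i).1.symm
  have hc : ∀ i j, G.Adj i j → (pb j t).card ≤ (pb i t).card := fun i j hij => by
    have h1 := hn i j hij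
    have h2 := card_symmDiff_mem _ _ (hs i)
    by_cases h : i ∈ pb j t
    · have h3 := card_symmDiff_mem _ _ h
      omega
    · have h3 := card_symmDiff_not_mem _ _ h
      omega
  have hm : ∀ i j, G.Adj i j → i ∈ pb j t := fun i j hij => by
    by_contra h
    have h1 := hn i j hij
    have h2 := card_symmDiff_mem _ _ (hs i)
    have h3 := card_symmDiff_not_mem _ _ h
    have h4 := hc j i hij.symm
    omega
  exact fun i j hij => ⟨hs i, hm j i hij.symm, hm i j hij, hs j⟩
end

section
/- Suppose G is connected and the family pb satisfies the self-add rule and the neighbor replacement rule. If the system is in deadlock at epoch t (i.e., D(i,t) holds for every agent i ∈ A), then all partial blocks have the same cardinality: for all i, j ∈ A, |pb_i(t)| = |pb_j(t)|. (Lemma 3 of the paper.) -/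
/-- Lemma 3: Under the self-add rule and the neighbor replacement rule, on a
connected network, if the system is in deadlock at epoch `t`, then all partial
blocks have the same cardinality. -/
theorem lemma3_same_length
    {A : Type*} [Fintype A] [DecidableEq A] [Nonempty A]
    (G : SimpleGraph A) (hconn : G.Connected)
    (pb : A → ℕ → Finset A) (L : ℕ)
    (hself : ∀ i t, i ∉ pb i t → (pb i t).card < L → pb i (t + 1) ≠ pb i t)
    (hnbr : ∀ i j t, G.Adj i j →
      (symmDiff (pb i t) {i}).card < (symmDiff (pb j t) {i}).card →
      (pb i t).card < L → pb i (t + 1) ≠ pb i t)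
    (t : ℕ)
    (hdead : ∀ i, pb i t = pb i (t + 1) ∧ (pb i t).card < L) :
    ∀ i j, (pb i t).card = (pb j t).card := by
  have hmem : ∀ i, i ∈ pb i t := by
    intro i
    by_contra h
    exact hself i t h (hdead i).2 (hdead i).1.symm
  have hle : ∀ i j, G.Adj i j → (pb j t).card ≤ (pb i t).card := by
    intro i j hij
    have h1 : (symmDiff (pb j t) {i}).card ≤ (symmDiff (pb i t) {i}).card := by
      by_contra h
      exact hnbr i j t hij (not_le.mp h) (hdead i).2 (hdead i).1.symm
    have h2 : symmDiff (pb i t) {i} = (pb i t).erase i := by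
      have := hmem i
      ext x
      simp only [Finset.mem_symmDiff, Finset.mem_singleton, Finset.mem_erase]
      grind
    have h3 : pb j t ⊆ insert i (symmDiff (pb j t) {i}) := by
      intro x hx
      simp only [Finset.mem_insert, Finset.mem_symmDiff, Finset.mem_singleton]
      tauto
    have h4 := Finset.card_le_card h3
    have h5 := Finset.card_insert_le i (symmDiff (pb j t) {i})
    have h6 := Finset.card_erase_add_one (hmem i)
    rw [h2] at h1
    omega
  intro i j
  obtain ⟨w⟩ := hconn.preconnected i j
  induction w with
  | nil => rfl
  | cons h _ ih => exact (le_antisymm (hle _ _ h.symm) (hle _ _ h)).trans ih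
end

section
/- Suppose G is connected, L ≤ |A|, and the family pb satisfies the self-add rule and the neighbor replacement rule. If the system is in deadlock at epoch t (i.e., D(i,t) holds for every agent i ∈ A), then there exist two neighboring agents with different partial blocks: there is an edge {i,j} ∈ E with pb_i(t) ≠ pb_j(t). (Lemma 4 of the paper.) -/
/-- Lemma 4: Under the self-add rule and the neighbor replacement rule, on a
connected network with `L ≤ |A|`, if the system is in deadlock at epoch `t`,
then there exist two neighboring agents with different partial blocks. -/
theorem lemma4_bad_neighbors
    {A : Type*} [Fintype A] [DecidableEq A] [Nonempty A]
    (G : SimpleGraph A) (hconn : G.Connected)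
    (pb : A → ℕ → Finset A) (L : ℕ) (hL : L ≤ Fintype.card A)
    (hself : ∀ i t, i ∉ pb i t → (pb i t).card < L → pb i (t + 1) ≠ pb i t)
    (hnbr : ∀ i j t, G.Adj i j →
      (symmDiff (pb i t) {i}).card < (symmDiff (pb j t) {i}).card →
      (pb i t).card < L → pb i (t + 1) ≠ pb i t)
    (t : ℕ)
    (hdead : ∀ i, pb i t = pb i (t + 1) ∧ (pb i t).card < L) :
    ∃ i j, G.Adj i j ∧ pb i t ≠ pb j t := by
  by_contra! hcon
  have hmem : ∀ i, i ∈ pb i t := by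
    intro i
    by_contra hi
    exact hself i t hi (hdead i).2 (hdead i).1.symm
  have hwalk : ∀ i j, G.Walk i j → pb i t = pb j t := by
    intro i j w
    induction w with
    | nil => rfl
    | cons h _ ih => exact (hcon _ _ h).trans ih
  obtain ⟨a⟩ := (inferInstance : Nonempty A)
  have huniv : pb a t = Finset.univ := by
    ext j
    obtain ⟨w⟩ := hconn.preconnected a j
    simp only [Finset.mem_univ, iff_true]
    rw [hwalk a j w]
    exact hmem j
  have hlt := (hdead a).2
  rw [huniv, Finset.card_univ] at hlt
  omega
end

section
/- Suppose G is connected, L = |A|, and the family pb satisfies the self-add rule, the neighbor replacement rule, and the direct messaging rule. Then the system is never in deadlock: there is no epoch t at which D(i,t) holds for every agent i ∈ A. (Theorem 1 of the paper.) -/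
/-- Theorem 1: On a connected network with `L = |A|`, under the self-add rule,
the neighbor replacement rule, and the direct messaging rule, the system is
never in deadlock. -/
theorem theorem1_no_deadlock_eq
    {A : Type*} [Fintype A] [DecidableEq A] [Nonempty A]
    (G : SimpleGraph A) (hconn : G.Connected)
    (pb : A → ℕ → Finset A) (L : ℕ) (hL : L = Fintype.card A)
    (hself : ∀ i t, i ∉ pb i t → (pb i t).card < L → pb i (t + 1) ≠ pb i t)
    (hnbr : ∀ i j t, G.Adj i j →
      (symmDiff (pb i t) {i}).card < (symmDiff (pb j t) {i}).card →
      (pb i t).card < L → pb i (t + 1) ≠ pb i t)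
    (hdm : ∀ i j k t, G.Adj i j → k ∈ pb j t → k ∉ pb i t →
      (symmDiff (pb k t) {k}).card < (symmDiff (pb i t) {k}).card →
      (pb k t).card < L → pb k (t + 1) ≠ pb k t) :
    ¬ ∃ t, ∀ i, pb i t = pb i (t + 1) ∧ (pb i t).card < L := by
  rintro ⟨t, ht⟩
  have hin : ∀ i, i ∈ pb i t := fun i => by
    by_contra h
    exact hself i t h (ht i).2 (ht i).1.symm
  have cin : ∀ (s : Finset A) (k : A), k ∈ s → (symmDiff s {k}).card + 1 = s.card := by
    intro s k hk
    have : symmDiff s {k} = s.erase k := by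
      ext x
      simp only [Finset.mem_symmDiff, Finset.mem_singleton, Finset.mem_erase]
      grind
    rw [this, Finset.card_erase_add_one hk]
  have cout : ∀ (s : Finset A) (k : A), k ∉ s → (symmDiff s {k}).card = s.card + 1 := by
    intro s k hk
    have : symmDiff s {k} = insert k s := by
      ext x
      simp only [Finset.mem_symmDiff, Finset.mem_singleton, Finset.mem_insert]
      grind
    rw [this, Finset.card_insert_of_notMem hk]
  have hle : ∀ i j, G.Adj i j → (pb j t).card ≤ (pb i t).card := by
    intro i j hij
    have h1 := cin _ _ (hin i)
    have h2 : ¬ (symmDiff (pb i t) {i}).card < (symmDiff (pb j t) {i}).card :=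
      fun h => hnbr i j t hij h (ht i).2 (ht i).1.symm
    by_cases h : i ∈ pb j t
    · have := cin _ _ h
      omega
    · have := cout _ _ h
      omega
  have hcard : ∀ i j, (pb j t).card ≤ (pb i t).card := by
    intro i j
    obtain ⟨w⟩ := hconn.preconnected i j
    induction w with
    | nil => exact le_rfl
    | cons h _ ih => exact ih.trans (hle _ _ h)
  have hsub : ∀ i j, G.Adj i j → pb j t ⊆ pb i t := by
    intro i j hij k hk
    by_contra hki
    have h1 := cin _ _ (hin k)
    have h2 := cout _ _ hki
    have h3 := hcard i k
    exact hdm i j k t hij hk hki (by omega) (ht k).2 (ht k).1.symm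
  have hall : ∀ i j, pb j t ⊆ pb i t := by
    intro i j
    obtain ⟨w⟩ := hconn.preconnected i j
    induction w with
    | nil => exact subset_rfl
    | cons h _ ih => exact ih.trans (hsub _ _ h)
  obtain ⟨a⟩ := ‹Nonempty A›
  have hu : pb a t = Finset.univ := Finset.eq_univ_iff_forall.2 fun k => hall a k (hin k)
  have := (ht a).2
  rw [hu, Finset.card_univ, hL] at this
  exact lt_irrefl _ this
end

section
/- Suppose G is connected, L ≤ |A|, and the family pb satisfies the self-add rule, the neighbor replacement rule, and the direct messaging rule. Then the system is never in deadlock: there is no epoch t at which D(i,t) holds for every agent i ∈ A. (Corollary 1 of the paper.) -/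
/-- Corollary 1: On a connected network with `L ≤ |A|`, under the self-add
rule, the neighbor replacement rule, and the direct messaging rule, the system
is never in deadlock. -/
theorem corollary1_no_deadlock_le
    {A : Type*} [Fintype A] [DecidableEq A] [Nonempty A]
    (G : SimpleGraph A) (hconn : G.Connected)
    (pb : A → ℕ → Finset A) (L : ℕ) (hL : L ≤ Fintype.card A)
    (hself : ∀ i t, i ∉ pb i t → (pb i t).card < L → pb i (t + 1) ≠ pb i t)
    (hnbr : ∀ i j t, G.Adj i j →
      (symmDiff (pb i t) {i}).card < (symmDiff (pb j t) {i}).card →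
      (pb i t).card < L → pb i (t + 1) ≠ pb i t)
    (hdm : ∀ i j k t, G.Adj i j → k ∈ pb j t → k ∉ pb i t →
      (symmDiff (pb k t) {k}).card < (symmDiff (pb i t) {k}).card →
      (pb k t).card < L → pb k (t + 1) ≠ pb k t) :
    ¬ ∃ t, ∀ i, pb i t = pb i (t + 1) ∧ (pb i t).card < L := by
  rintro ⟨t, ht⟩
  have hmem : ∀ i, i ∈ pb i t := by
    intro i
    by_contra h
    exact hself i t h (ht i).2 (ht i).1.symm
  have hin : ∀ (s : Finset A) (a : A), a ∈ s → (symmDiff s {a}).card + 1 = s.card := by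
    intro s a h
    have : symmDiff s {a} = s.erase a := by
      ext x
      simp only [Finset.mem_symmDiff, Finset.mem_singleton, Finset.mem_erase]
      grind
    rw [this, Finset.card_erase_add_one h]
  have hout : ∀ (s : Finset A) (a : A), a ∉ s → (symmDiff s {a}).card = s.card + 1 := by
    intro s a h
    have : symmDiff s {a} = insert a s := by
      ext x
      simp only [Finset.mem_symmDiff, Finset.mem_singleton, Finset.mem_insert]
      grind
    rw [this, Finset.card_insert_of_notMem h]
  have hle : ∀ i j, G.Adj i j → (pb j t).card ≤ (pb i t).card := by
    intro i j hij
    by_contra hlt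
    refine hnbr i j t hij ?_ (ht i).2 (ht i).1.symm
    have h1 := hin _ _ (hmem i)
    by_cases h : i ∈ pb j t
    · have h2 := hin _ _ h
      omega
    · have h2 := hout _ _ h
      omega
  have hcard : ∀ i j, (pb i t).card = (pb j t).card := by
    intro i j
    obtain ⟨w⟩ := hconn.preconnected i j
    induction w with
    | nil => rfl
    | cons h _ ih => exact (le_antisymm (hle _ _ h.symm) (hle _ _ h)).trans ih
  have hsub : ∀ i j, G.Adj i j → pb j t ⊆ pb i t := by
    intro i j hij k hk
    by_contra hki
    refine hdm i j k t hij hk hki ?_ (ht k).2 (ht k).1.symm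
    have h1 := hin _ _ (hmem k)
    have h2 := hout _ _ hki
    have h3 := hcard k i
    omega
  have heq : ∀ i j, pb i t = pb j t := by
    intro i j
    obtain ⟨w⟩ := hconn.preconnected i j
    induction w with
    | nil => rfl
    | cons h _ ih => exact (Finset.Subset.antisymm (hsub _ _ h.symm) (hsub _ _ h)).trans ih
  obtain ⟨a⟩ := ‹Nonempty A›
  have huniv : pb a t = Finset.univ := by
    ext x
    simp only [Finset.mem_univ, iff_true]
    rw [heq a x]
    exact hmem x
  have h := (ht a).2
  rw [huniv, Finset.card_univ] at h
  omega
end
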